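/- arXiv:funct-an/9703004 — 6 statements merged into one kernel-verified Lean document; each statement's English description precedes it below -/
import Mathlib

section
/- Let u : H₀ → P be a β-cocycle at x₀ and define v : H × X → P by v_{(g,x)} := β_{(h(g•x), x₀)}(u_{k(g,x)}). Then v is a groupoid cocycle for β, i.e. v_{(g·g', x)} = v_{(g, g'•x)} · β_{(g, g'•x)}(v_{(g', x)}) for all g, g' ∈ H and x ∈ X. -/
/-- If `u : H₀ → P` is a `β`-cocycle at `x₀` and
`v_(g,x) := β_(h(g•x), x₀)(u_(k(g,x)))`, then `v` is a groupoid cocycle for `β`: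
`v_(g*g', x) = v_(g, g'•x) * β_(g, g'•x)(v_(g', x))`. -/
theorem stmt_1 {H X P : Type*} [Group H] [MulAction H X] [Group P]
    (x₀ : X) (h : X → H) (hh : ∀ x, h x • x₀ = x)
    (β : H → X → MulAut P)
    (hβ : ∀ (g g' : H) (x : X), β g (g' • x) * β g' x = β (g * g') x)
    (u : H → P)
    (hu : ∀ g ∈ MulAction.stabilizer H x₀, ∀ g' ∈ MulAction.stabilizer H x₀,
      u (g * g') = u g * β g x₀ (u g'))
    (v : H → X → P)
    (hv : ∀ (g : H) (x : X), v g x = β (h (g • x)) x₀ (u ((h (g • x))⁻¹ * g * h x))) :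
    ∀ (g g' : H) (x : X), v (g * g') x = v g (g' • x) * β g (g' • x) (v g' x) := by
  intro g g' x
  have hk : ∀ (g : H) (x : X), (h (g • x))⁻¹ * g * h x ∈ MulAction.stabilizer H x₀ := by
    intro g x
    rw [MulAction.mem_stabilizer_iff, mul_smul, mul_smul, hh, inv_smul_eq_iff, hh]
  have h1 := hk g (g' • x)
  have h2 := hk g' x
  have e : (h (g • g' • x))⁻¹ * (g * g') * h x
      = ((h (g • g' • x))⁻¹ * g * h (g' • x)) * ((h (g' • x))⁻¹ * g' * h x) := by group
  have a1 := hβ (h (g • g' • x)) ((h (g • g' • x))⁻¹ * g * h (g' • x)) x₀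
  rw [MulAction.mem_stabilizer_iff.mp h1] at a1
  have a2 := hβ g (h (g' • x)) x₀
  rw [hh] at a2
  have e2 : h (g • g' • x) * ((h (g • g' • x))⁻¹ * g * h (g' • x)) = g * h (g' • x) := by group
  rw [e2, ← a2] at a1
  rw [hv, hv, hv, mul_smul, e, hu _ h1 _ h2, map_mul, ← MulAut.mul_apply, a1, MulAut.mul_apply]
end

section
/- Let α and β be groupoid actions of H⋉X on P, let θ be an automorphism of P, and let u : H₀ → P satisfy θ ∘ α_{(g,x₀)} ∘ θ⁻¹ = Ad(u_g) ∘ β_{(g,x₀)} for every g ∈ H₀. Define θ_x := β_{(h(x),x₀)} ∘ θ ∘ α_{(h(x),x₀)}⁻¹ for x ∈ X and v_{(g,x)} := β_{(h(g•x), x₀)}(u_{k(g,x)}) for (g,x) ∈ H × X. Then θ_{g•x} ∘ α_{(g,x)} ∘ θ_x⁻¹ = Ad(v_{(g,x)}) ∘ β_{(g,x)} for all g ∈ H and x ∈ X. -/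
/-- If `θ ∘ α_(g,x₀) ∘ θ⁻¹ = Ad(u_g) ∘ β_(g,x₀)` for every `g ∈ H₀`,
`θ_x := β_(h(x),x₀) ∘ θ ∘ α_(h(x),x₀)⁻¹` and `v_(g,x) := β_(h(g•x), x₀)(u_(k(g,x)))`,
then `θ_(g•x) ∘ α_(g,x) ∘ θ_x⁻¹ = Ad(v_(g,x)) ∘ β_(g,x)` for all `g ∈ H`, `x ∈ X`. -/
theorem stmt_2 {H X P : Type*} [Group H] [MulAction H X] [Group P]
    (x₀ : X) (h : X → H) (hh : ∀ x, h x • x₀ = x)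
    (α β : H → X → MulAut P)
    (hα : ∀ (g g' : H) (x : X), α g (g' • x) * α g' x = α (g * g') x)
    (hβ : ∀ (g g' : H) (x : X), β g (g' • x) * β g' x = β (g * g') x)
    (θ : MulAut P) (u : H → P)
    (hconj : ∀ g ∈ MulAction.stabilizer H x₀,
      θ * α g x₀ * θ⁻¹ = MulAut.conj (u g) * β g x₀)
    (Θ : X → MulAut P)
    (hΘ : ∀ x, Θ x = β (h x) x₀ * θ * (α (h x) x₀)⁻¹)
    (v : H → X → P)
    (hv : ∀ (g : H) (x : X), v g x = β (h (g • x)) x₀ (u ((h (g • x))⁻¹ * g * h x))) :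
    ∀ (g : H) (x : X), Θ (g • x) * α g x * (Θ x)⁻¹ = MulAut.conj (v g x) * β g x := by
  intro g x
  have key : ∀ γ : H → X → MulAut P,
      (∀ (g g' : H) (x : X), γ g (g' • x) * γ g' x = γ (g * g') x) →
      γ g x = γ (h (g • x)) x₀ * γ ((h (g • x))⁻¹ * g * h x) x₀ * (γ (h x) x₀)⁻¹ := by
    intro γ hγ
    have h1 := hγ g (h x) x₀
    have h2 := hγ (h (g • x)) ((h (g • x))⁻¹ * g * h x) x₀
    have h3 : ((h (g • x))⁻¹ * g * h x) • x₀ = x₀ := by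
      rw [mul_smul, mul_smul, hh, inv_smul_eq_iff, hh]
    rw [h3] at h2
    rw [hh] at h1
    rw [h2, eq_mul_inv_iff_mul_eq, h1]
    congr 1
    group
  have hk : (h (g • x))⁻¹ * g * h x ∈ MulAction.stabilizer H x₀ := by
    rw [MulAction.mem_stabilizer_iff, mul_smul, mul_smul, hh, inv_smul_eq_iff, hh]
  have hc := hconj _ hk
  have hAd : ∀ (φ : MulAut P) (p : P), MulAut.conj (φ p) = φ * MulAut.conj p * φ⁻¹ := by
    intro φ p
    ext q
    simp
  rw [hΘ, hΘ, hv, hAd, key α hα, key β hβ]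
  calc _ = β (h (g • x)) x₀ * (θ * α ((h (g • x))⁻¹ * g * h x) x₀ * θ⁻¹) * (β (h x) x₀)⁻¹ := by
        group
    _ = _ := by
        rw [hc]
        group
end

section
/- Let u : H₀ → P be a β-cocycle at x₀, define v : H × X → P by v_{(g,x)} := β_{(h(g•x), x₀)}(u_{k(g,x)}), and define ũ_g ∈ ∏_{x∈X} P by ũ_g(x) := v_{(g, g⁻¹•x)}. Then ũ is a cocycle for the induced action β̃ of H on ∏_{x∈X} P, i.e. ũ_{g·g'} = ũ_g · β̃_g(ũ_{g'}) for all g, g' ∈ H. -/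
/-- If `u : H₀ → P` is a `β`-cocycle at `x₀`,
`v_(g,x) := β_(h(g•x), x₀)(u_(k(g,x)))`, and `ũ_g(x) := v_(g, g⁻¹•x)`, then `ũ`
is a cocycle for the induced action `β̃` of `H` on `∏_{x∈X} P`:
`ũ_(g*g') = ũ_g * β̃_g(ũ_(g'))`. -/
theorem stmt_4 {H X P : Type*} [Group H] [MulAction H X] [Group P]
    (x₀ : X) (h : X → H) (hh : ∀ x, h x • x₀ = x)
    (β : H → X → MulAut P)
    (hβ : ∀ (g g' : H) (x : X), β g (g' • x) * β g' x = β (g * g') x)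
    (u : H → P)
    (hu : ∀ g ∈ MulAction.stabilizer H x₀, ∀ g' ∈ MulAction.stabilizer H x₀,
      u (g * g') = u g * β g x₀ (u g'))
    (v : H → X → P)
    (hv : ∀ (g : H) (x : X), v g x = β (h (g • x)) x₀ (u ((h (g • x))⁻¹ * g * h x)))
    (B : H → MulAut (X → P))
    (hB : ∀ (g : H) (f : X → P) (x : X), B g f x = β g (g⁻¹ • x) (f (g⁻¹ • x)))
    (ut : H → X → P)
    (hut : ∀ (g : H) (x : X), ut g x = v g (g⁻¹ • x)) :
    ∀ (g g' : H), ut (g * g') = ut g * B g (ut g') := by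
  have hinv : ∀ x, (h x)⁻¹ • x = x₀ := fun x => by
    rw [inv_smul_eq_iff]; exact (hh x).symm
  have hk : ∀ (g : H) (x : X), (h (g • x))⁻¹ * g * h x ∈ MulAction.stabilizer H x₀ := by
    intro g x
    rw [MulAction.mem_stabilizer_iff, mul_smul, mul_smul, hh, hinv]
  have key : ∀ (g g' : H) (z : X),
      v (g * g') z = v g (g' • z) * β g (g' • z) (v g' z) := by
    intro g g' z
    have ha := hk g (g' • z)
    have hb := hk g' z
    have e1 : (h ((g * g') • z))⁻¹ * (g * g') * h z =
        ((h (g • g' • z))⁻¹ * g * h (g' • z)) * ((h (g' • z))⁻¹ * g' * h z) := by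
      rw [mul_smul]; group
    have e2 := hβ (h (g • g' • z)) ((h (g • g' • z))⁻¹ * g * h (g' • z)) x₀
    rw [MulAction.mem_stabilizer_iff.mp ha] at e2
    have e3 := hβ g (h (g' • z)) x₀
    rw [hh] at e3
    have e4 : h (g • g' • z) * ((h (g • g' • z))⁻¹ * g * h (g' • z)) = g * h (g' • z) := by
      group
    rw [e4, ← e3] at e2
    rw [hv (g * g') z, e1, hu _ ha _ hb, map_mul, mul_smul, hv g (g' • z), hv g' z]
    congr 1
    exact DFunLike.congr_fun e2 _
  intro g g'
  funext x
  rw [Pi.mul_apply, hB, hut, hut, hut, key, mul_inv_rev, mul_smul, smul_inv_smul]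
end

section
/- Let α and β be groupoid actions of H⋉X on P, let θ be an automorphism of P, and let u : H₀ → P be a β-cocycle at x₀ satisfying θ ∘ α_{(g,x₀)} ∘ θ⁻¹ = Ad(u_g) ∘ β_{(g,x₀)} for every g ∈ H₀. Define θ_x := β_{(h(x),x₀)} ∘ θ ∘ α_{(h(x),x₀)}⁻¹, let θ̃ be the automorphism of ∏_{x∈X} P given by (θ̃ f)(x) := θ_x(f(x)), define v_{(g,x)} := β_{(h(g•x), x₀)}(u_{k(g,x)}), and set ũ_g(x) := v_{(g, g⁻¹•x)}. Then θ̃ ∘ α̃_g ∘ θ̃⁻¹ = Ad(ũ_g) ∘ β̃_g for every g ∈ H, where α̃ and β̃ are the induced actions of H on ∏_{x∈X} P and Ad(ũ_g) is the inner automorphism of ∏_{x∈X} P determined by ũ_g. -/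
/-- With `θ`, `u` as in a cocycle conjugacy over the stabilizer `H₀`,
`θ_x := β_(h(x),x₀) ∘ θ ∘ α_(h(x),x₀)⁻¹`, `θ̃` acting pointwise,
`v_(g,x) := β_(h(g•x), x₀)(u_(k(g,x)))` and `ũ_g(x) := v_(g, g⁻¹•x)`, we have
`θ̃ ∘ α̃_g ∘ θ̃⁻¹ = Ad(ũ_g) ∘ β̃_g` for every `g ∈ H`. -/
theorem stmt_5 {H X P : Type*} [Group H] [MulAction H X] [Group P]
    (x₀ : X) (h : X → H) (hh : ∀ x, h x • x₀ = x)
    (α β : H → X → MulAut P)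
    (hα : ∀ (g g' : H) (x : X), α g (g' • x) * α g' x = α (g * g') x)
    (hβ : ∀ (g g' : H) (x : X), β g (g' • x) * β g' x = β (g * g') x)
    (θ : MulAut P) (u : H → P)
    (hu : ∀ g ∈ MulAction.stabilizer H x₀, ∀ g' ∈ MulAction.stabilizer H x₀,
      u (g * g') = u g * β g x₀ (u g'))
    (hconj : ∀ g ∈ MulAction.stabilizer H x₀,
      θ * α g x₀ * θ⁻¹ = MulAut.conj (u g) * β g x₀)
    (Θ : X → MulAut P)
    (hΘ : ∀ x, Θ x = β (h x) x₀ * θ * (α (h x) x₀)⁻¹)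
    (Θt : MulAut (X → P))
    (hΘt : ∀ (f : X → P) (x : X), Θt f x = Θ x (f x))
    (v : H → X → P)
    (hv : ∀ (g : H) (x : X), v g x = β (h (g • x)) x₀ (u ((h (g • x))⁻¹ * g * h x)))
    (ut : H → X → P)
    (hut : ∀ (g : H) (x : X), ut g x = v g (g⁻¹ • x))
    (A B : H → MulAut (X → P))
    (hA : ∀ (g : H) (f : X → P) (x : X), A g f x = α g (g⁻¹ • x) (f (g⁻¹ • x)))
    (hB : ∀ (g : H) (f : X → P) (x : X), B g f x = β g (g⁻¹ • x) (f (g⁻¹ • x))) :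
    ∀ (g : H), Θt * A g * Θt⁻¹ = MulAut.conj (ut g) * B g := by
  have key : ∀ (g : H) (y : X),
      Θ (g • y) * α g y = MulAut.conj (v g y) * β g y * Θ y := by
    intro g y
    rw [hΘ, hΘ, hv]
    have hk : ((h (g • y))⁻¹ * g * h y) • x₀ = x₀ := by
      rw [mul_smul, hh, mul_smul, inv_smul_eq_iff, hh]
    have hc := hconj _ (MulAction.mem_stabilizer_iff.2 hk)
    have e : ∀ γ : H → X → MulAut P,
        (∀ (g g' : H) (x : X), γ g (g' • x) * γ g' x = γ (g * g') x) →
        γ (h (g • y)) x₀ * γ ((h (g • y))⁻¹ * g * h y) x₀ = γ g y * γ (h y) x₀ := by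
      intro γ hγ
      have h1 := hγ (h (g • y)) ((h (g • y))⁻¹ * g * h y) x₀
      have h2 := hγ g (h y) x₀
      rw [hk] at h1
      rw [hh] at h2
      rw [h1, h2]
      congr 1
      group
    have ea := e α hα
    have eb := e β hβ
    generalize (h (g • y))⁻¹ * g * h y = k at *
    have hcj : ∀ (φ : MulAut P) (p : P), MulAut.conj (φ p) = φ * MulAut.conj p * φ⁻¹ := by
      intro φ p
      ext q
      simp [MulAut.mul_apply]
    have ea' : α g y = α (h (g • y)) x₀ * α k x₀ * (α (h y) x₀)⁻¹ := by
      rw [ea]; group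
    have eb' : β g y = β (h (g • y)) x₀ * β k x₀ * (β (h y) x₀)⁻¹ := by
      rw [eb]; group
    have hc' : θ * α k x₀ = MulAut.conj (u k) * β k x₀ * θ := by
      rw [← hc]; group
    rw [hcj, ea', eb']
    calc _ = β (h (g • y)) x₀ * (θ * α k x₀) * (α (h y) x₀)⁻¹ := by group
      _ = _ := by rw [hc']; group
  intro g
  rw [mul_inv_eq_iff_eq_mul]
  ext f x
  have hx := DFunLike.congr_fun (key g (g⁻¹ • x)) (f (g⁻¹ • x))
  rw [smul_inv_smul] at hx
  simp only [MulAut.mul_apply, MulAut.conj_apply, Pi.mul_apply, Pi.inv_apply, hΘt, hA, hB, hut]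
    at hx ⊢
  exact hx
end

section
/- Let α and β be groupoid actions of H⋉X on P and suppose there exist an automorphism θ of P and a β-cocycle u : H₀ → P at x₀ such that θ ∘ α_{(g,x₀)} ∘ θ⁻¹ = Ad(u_g) ∘ β_{(g,x₀)} for every g ∈ H₀. Then the induced actions α̃ and β̃ of H on ∏_{x∈X} P are cocycle conjugate: there exist an automorphism Θ of ∏_{x∈X} P and a map w : H → ∏_{x∈X} P satisfying w_{g·g'} = w_g · β̃_g(w_{g'}) and Θ ∘ α̃_g ∘ Θ⁻¹ = Ad(w_g) ∘ β̃_g for all g, g' ∈ H. -/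
/-- If two groupoid actions `α`, `β` of `H⋉X` on `P` are cocycle
conjugate over the stabilizer `H₀` (via an automorphism `θ` of `P` and a
`β`-cocycle `u : H₀ → P` at `x₀`), then the induced actions `α̃` and `β̃` of `H`
on `∏_{x∈X} P` are cocycle conjugate. -/
theorem stmt_6 {H X P : Type*} [Group H] [MulAction H X] [Group P]
    (x₀ : X) (h : X → H) (hh : ∀ x, h x • x₀ = x)
    (α β : H → X → MulAut P)
    (hα : ∀ (g g' : H) (x : X), α g (g' • x) * α g' x = α (g * g') x)
    (hβ : ∀ (g g' : H) (x : X), β g (g' • x) * β g' x = β (g * g') x)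
    (hcc : ∃ (θ : MulAut P) (u : H → P),
      (∀ g ∈ MulAction.stabilizer H x₀, ∀ g' ∈ MulAction.stabilizer H x₀,
        u (g * g') = u g * β g x₀ (u g')) ∧
      (∀ g ∈ MulAction.stabilizer H x₀,
        θ * α g x₀ * θ⁻¹ = MulAut.conj (u g) * β g x₀))
    (A B : H → MulAut (X → P))
    (hA : ∀ (g : H) (f : X → P) (x : X), A g f x = α g (g⁻¹ • x) (f (g⁻¹ • x)))
    (hB : ∀ (g : H) (f : X → P) (x : X), B g f x = β g (g⁻¹ • x) (f (g⁻¹ • x))) :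
    ∃ (Θ : MulAut (X → P)) (w : H → X → P),
      (∀ (g g' : H), w (g * g') = w g * B g (w g')) ∧
      (∀ (g : H), Θ * A g * Θ⁻¹ = MulAut.conj (w g) * B g) := by
  obtain ⟨θ, u, hu, hθ⟩ := hcc
  have hs : ∀ (g : H) (y : X),
      (h y)⁻¹ * g * h (g⁻¹ • y) ∈ MulAction.stabilizer H x₀ := by
    intro g y
    rw [MulAction.mem_stabilizer_iff, mul_smul, mul_smul, hh, smul_inv_smul, inv_smul_eq_iff, hh]
  have key : ∀ γ : H → X → MulAut P,
      (∀ (g g' : H) (x : X), γ g (g' • x) * γ g' x = γ (g * g') x) →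
      ∀ (g : H) (y : X) (p : P), γ g (g⁻¹ • y) (γ (h (g⁻¹ • y)) x₀ p) =
        γ (h y) x₀ (γ ((h y)⁻¹ * g * h (g⁻¹ • y)) x₀ p) := by
    intro γ hγ g y p
    have h1 := hγ g (h (g⁻¹ • y)) x₀
    have h2 := hγ (h y) ((h y)⁻¹ * g * h (g⁻¹ • y)) x₀
    rw [hh] at h1
    rw [MulAction.mem_stabilizer_iff.1 (hs g y)] at h2
    have h3 : h y * ((h y)⁻¹ * g * h (g⁻¹ • y)) = g * h (g⁻¹ • y) := by group
    rw [h3, ← h1] at h2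
    exact (DFunLike.congr_fun h2 p).symm
  refine ⟨MulEquiv.piCongrRight (fun x => (β (h x) x₀ * θ * (α (h x) x₀)⁻¹ : MulAut P)),
    fun g y => β (h y) x₀ (u ((h y)⁻¹ * g * h (g⁻¹ • y))), ?_, ?_⟩
  · intro g g'
    funext y
    rw [Pi.mul_apply, hB, key β hβ, ← map_mul, ← hu _ (hs g y) _ (hs g' (g⁻¹ • y))]
    simp only [mul_inv_rev, mul_smul, mul_assoc, mul_inv_cancel_left]
  · intro g
    rw [mul_inv_eq_iff_eq_mul]
    ext f y
    have hf : f (g⁻¹ • y) = α (h (g⁻¹ • y)) x₀ ((α (h (g⁻¹ • y)) x₀)⁻¹ (f (g⁻¹ • y))) := by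
      simp
    have h4 := DFunLike.congr_fun (hθ _ (hs g y)) (θ ((α (h (g⁻¹ • y)) x₀)⁻¹ (f (g⁻¹ • y))))
    simp only [MulAut.mul_apply, MulAut.inv_apply_self, MulAut.conj_apply] at h4
    simp only [MulAut.mul_apply, MulAut.conj_apply, Pi.mul_apply, Pi.inv_apply, hB,
      MulEquiv.piCongrRight_apply, hA]
    rw [key β hβ, ← map_inv, ← map_mul, ← map_mul, ← h4]
    conv_lhs => rw [hf, key α hα, MulAut.inv_apply_self]
end

section
/- Let g ∈ H be an element that fixes every point of X and commutes with h(x) in H for every x ∈ X, and suppose a ∈ P satisfies α_{(g,x₀)}(b) · a = a · b for all b ∈ Q. Define ã ∈ ∏_{x∈X} P by ã(x) := α_{(h(x),x₀)}(a), and let α̃_g be the ring automorphism of ∏_{x∈X} P given by (α̃_g f)(x) := α_{(g,x)}(f(x)) (using that g fixes every point of X). Then α̃_g(f) · ã = ã · f for every f ∈ ∏_{x∈X} P such that f(x) ∈ Q for all x ∈ X. -/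
/-- With `g` fixing every point of `X` and commuting with every
`h(x)`, and `a ∈ P` with `α_(g,x₀)(b) * a = a * b` for all `b ∈ Q`, define
`ã(x) := α_(h(x),x₀)(a)` in `∏_{x∈X} P` and let `α̃_g` be the ring automorphism
of `∏_{x∈X} P` given by `(α̃_g f)(x) := α_(g,x)(f(x))`. Then
`α̃_g(f) * ã = ã * f` for every `f ∈ ∏_{x∈X} P` with `f(x) ∈ Q` for all `x`. -/
theorem stmt_8 {H X P : Type*} [Group H] [MulAction H X] [Ring P]
    (x₀ : X) (h : X → H) (hh : ∀ x, h x • x₀ = x)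
    (α : H → X → (P ≃+* P))
    (hα : ∀ (g g' : H) (x : X) (p : P),
      α g (g' • x) (α g' x p) = α (g * g') x p)
    (Q : Subring P)
    (hQ : ∀ (g : H) (x : X), Q.map (α g x : P →+* P) = Q)
    (g : H) (hgfix : ∀ x : X, g • x = x) (hgcomm : ∀ x : X, g * h x = h x * g)
    (a : P) (ha : ∀ b ∈ Q, α g x₀ b * a = a * b)
    (at' : X → P) (hat : ∀ x : X, at' x = α (h x) x₀ a)
    (A : (X → P) ≃+* (X → P))
    (hA : ∀ (f : X → P) (x : X), A f x = α g x (f x)) :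
    ∀ f : X → P, (∀ x, f x ∈ Q) → A f * at' = at' * f := by
  intro f hf
  funext x
  have hx := hf x
  rw [← hQ (h x) x₀] at hx
  obtain ⟨b, hb, hbx⟩ := Subring.mem_map.1 hx
  have hbx' : α (h x) x₀ b = f x := hbx
  have h1 := hα g (h x) x₀ b
  have h2 := hα (h x) g x₀ b
  rw [hh x] at h1
  rw [hgfix x₀] at h2
  rw [Pi.mul_apply, Pi.mul_apply, hA, hat, ← hbx', h1, hgcomm, ← h2, ← map_mul, ← map_mul, ha b hb]
end
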